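/- arXiv:2503.24358 — 4 statements merged into one kernel-verified Lean document; each statement's English description precedes it below -/
import Mathlib

section
/- Let d, n be positive integers, q ∈ ℝ^d, and for i = 1,…,n let k_i, k_i', v_i, v_i' ∈ ℝ^d. Define w, w' ∈ ℝ^n by w_i = ⟨q, k_i⟩/√d and w_i' = ⟨q, k_i'⟩/√d, and define the attention outputs Attn = Σ_{i=1}^n softmax(w)_i · v_i and Attn' = Σ_{i=1}^n softmax(w')_i · v_i'. Let V' ∈ ℝ^{n×d} be the matrix whose i-th row is v_i'. Then ‖Attn − Attn'‖₂ ≤ (‖V'‖_F / (2√d)) · Σ_{i=1}^n |⟨q, k_i − k_i'⟩| + Σ_{i=1}^n ‖v_i − v_i'‖₂. -/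
open Finset

/-- softmax(x)_i = exp(x_i) / ∑_j exp(x_j) -/
noncomputable def softmax {n : ℕ} (x : Fin n → ℝ) : Fin n → ℝ :=
  fun i => Real.exp (x i) / ∑ j, Real.exp (x j)

lemma softmax_nonneg {n : ℕ} (x : Fin n → ℝ) (i : Fin n) : 0 ≤ softmax x i :=
  div_nonneg (Real.exp_nonneg _) (sum_nonneg fun _ _ => Real.exp_nonneg _)

lemma softmax_le_one {n : ℕ} (x : Fin n → ℝ) (i : Fin n) : softmax x i ≤ 1 :=
  div_le_one_of_le₀
    (single_le_sum (f := fun j => Real.exp (x j)) (fun _ _ => Real.exp_nonneg _) (mem_univ i))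
    (sum_nonneg fun _ _ => Real.exp_nonneg _)

lemma mul_abs_sub_weighted_sum_le {ι : Type*} [Fintype ι] (e s : ι → ℝ)
    (he : ∀ i, 0 ≤ e i) (hs : ∀ i, |s i| ≤ 1) (i : ι) :
    e i * |s i * ∑ j, e j - ∑ j, s j * e j| ≤ (∑ j, e j) ^ 2 / 2 := by
  classical
  have hsub : |s i * ∑ j, e j - ∑ j, s j * e j| ≤ 2 * (∑ j, e j - e i) := by
    have h1 : s i * ∑ j, e j - ∑ j, s j * e j = ∑ j ∈ univ.erase i, (s i - s j) * e j := by
      rw [sum_erase _ (by simp), mul_sum, ← sum_sub_distrib]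
      exact sum_congr rfl fun j _ => by ring
    have h2 : ∑ j, e j - e i = ∑ j ∈ univ.erase i, e j := by
      rw [← add_sum_erase univ e (mem_univ i)]; ring
    rw [h1, h2, mul_sum]
    refine (abs_sum_le_sum_abs _ _).trans (sum_le_sum fun j _ => ?_)
    rw [abs_mul, abs_of_nonneg (he j)]
    have := abs_sub (s i) (s j)
    exact mul_le_mul_of_nonneg_right (by linarith [hs i, hs j]) (he j)
  have := mul_le_mul_of_nonneg_left hsub (he i)
  nlinarith [sq_nonneg (∑ j, e j - 2 * e i)]

lemma abs_sum_mul_softmax_sub_le {n : ℕ} (hn : 0 < n) (x y s : Fin n → ℝ)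
    (hs : ∀ i, |s i| ≤ 1) :
    |∑ i, s i * softmax x i - ∑ i, s i * softmax y i| ≤ 1 / 2 * ∑ i, |x i - y i| := by
  have : NeZero n := ⟨hn.ne'⟩
  let e : ℝ → Fin n → ℝ := fun t i => Real.exp (y i + t * (x i - y i))
  have hpos : ∀ t, 0 < ∑ i, e t i := fun t =>
    sum_pos (fun i _ => Real.exp_pos _) univ_nonempty
  have he : ∀ t i, HasDerivAt (fun t => e t i) (e t i * (x i - y i)) t := fun t i => by
    simpa using (((hasDerivAt_id t).mul_const (x i - y i)).const_add (y i)).exp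
  have hderiv : ∀ t, HasDerivAt (fun t => (∑ i, s i * e t i) / ∑ i, e t i)
      (((∑ i, s i * (e t i * (x i - y i))) * (∑ i, e t i) -
        (∑ i, s i * e t i) * ∑ i, e t i * (x i - y i)) / (∑ i, e t i) ^ 2) t := fun t =>
    (HasDerivAt.fun_sum fun i _ => (he t i).const_mul (s i)).fun_div
      (HasDerivAt.fun_sum fun i _ => he t i) (hpos t).ne'
  have hbound : ∀ t, ‖((∑ i, s i * (e t i * (x i - y i))) * (∑ i, e t i) -
        (∑ i, s i * e t i) * ∑ i, e t i * (x i - y i)) / (∑ i, e t i) ^ 2‖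
      ≤ 1 / 2 * ∑ i, |x i - y i| := fun t => by
    have hpos2 := pow_pos (hpos t) 2
    rw [Real.norm_eq_abs, abs_div, abs_of_pos hpos2, div_le_iff₀ hpos2, sum_mul, mul_sum,
      ← sum_sub_distrib, mul_sum, sum_mul]
    refine (abs_sum_le_sum_abs _ _).trans (sum_le_sum fun i _ => ?_)
    have hfactor : s i * (e t i * (x i - y i)) * (∑ j, e t j) -
        (∑ j, s j * e t j) * (e t i * (x i - y i)) =
        (x i - y i) * (e t i * (s i * ∑ j, e t j - ∑ j, s j * e t j)) := by ring
    rw [hfactor, abs_mul, abs_mul, abs_of_pos (show 0 < e t i from Real.exp_pos _)]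
    have := mul_le_mul_of_nonneg_left
      (mul_abs_sub_weighted_sum_le (e t) s (fun _ => Real.exp_nonneg _) hs i)
      (abs_nonneg (x i - y i))
    linarith
  have hmvt := convex_univ.norm_image_sub_le_of_norm_hasDerivWithin_le (x := (0 : ℝ)) (y := 1)
    (fun t _ => (hderiv t).hasDerivWithinAt) (fun t _ => hbound t) (Set.mem_univ _)
    (Set.mem_univ _)
  simpa [e, softmax, mul_div_assoc, sum_div] using hmvt

/-- The softmax map is `1/2`-Lipschitz for the `ℓ¹` norm. -/
lemma sum_abs_softmax_sub_le {n : ℕ} (hn : 0 < n) (x y : Fin n → ℝ) :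
    ∑ i, |softmax x i - softmax y i| ≤ 1 / 2 * ∑ i, |x i - y i| := by
  let s : Fin n → ℝ := fun i => SignType.sign (softmax x i - softmax y i)
  have hs : ∀ i, |s i| ≤ 1 := fun i => by
    rcases lt_trichotomy (softmax x i - softmax y i) 0 with h | h | h <;> simp [s, h]
  refine le_trans (le_of_eq ?_) ((le_abs_self _).trans (abs_sum_mul_softmax_sub_le hn x y s hs))
  rw [← sum_sub_distrib]
  refine sum_congr rfl fun i _ => ?_
  rw [← mul_sub, sign_mul_self]

lemma sqrt_sum_sq_eq_norm {d : ℕ} (a : Fin d → ℝ) :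
    Real.sqrt (∑ j, a j ^ 2) = ‖WithLp.toLp 2 a‖ := by
  simp [EuclideanSpace.norm_eq]

lemma norm_sum_smul_sub_sum_smul_le {ι E : Type*} [Fintype ι] [NormedAddCommGroup E]
    [NormedSpace ℝ E] (p p' : ι → ℝ) (v v' : ι → E) {C : ℝ} (hp : ∀ i, |p i| ≤ 1)
    (hC : ∀ i, ‖v' i‖ ≤ C) :
    ‖∑ i, p i • v i - ∑ i, p' i • v' i‖ ≤ C * ∑ i, |p i - p' i| + ∑ i, ‖v i - v' i‖ := by
  rw [← sum_sub_distrib, mul_sum, ← sum_add_distrib]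
  refine (norm_sum_le _ _).trans (sum_le_sum fun i _ => ?_)
  have hsplit : p i • v i - p' i • v' i = (p i - p' i) • v' i + p i • (v i - v' i) := by module
  rw [hsplit]
  refine (norm_add_le _ _).trans ?_
  rw [norm_smul, norm_smul, Real.norm_eq_abs, Real.norm_eq_abs, mul_comm C]
  exact add_le_add (mul_le_mul_of_nonneg_left (hC i) (abs_nonneg _))
    (mul_le_of_le_one_left (norm_nonneg _) (hp i))

/-- **Theorem 1** (attention output perturbation bound). -/
theorem attention_output_bound (d n : ℕ) (hd : 0 < d) (hn : 0 < n)
    (q : Fin d → ℝ) (k k' v v' : Fin n → Fin d → ℝ) :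
    -- Euclidean inner product on ℝ^d
    let inner : (Fin d → ℝ) → (Fin d → ℝ) → ℝ := fun a b => ∑ j, a j * b j
    -- Euclidean norm on ℝ^d
    let norm2 : (Fin d → ℝ) → ℝ := fun a => Real.sqrt (∑ j, (a j) ^ 2)
    -- attention logits
    let w : Fin n → ℝ := fun i => inner q (k i) / Real.sqrt d
    let w' : Fin n → ℝ := fun i => inner q (k' i) / Real.sqrt d
    -- attention outputs
    let Attn : Fin d → ℝ := fun j => ∑ i, softmax w i * v i j
    let Attn' : Fin d → ℝ := fun j => ∑ i, softmax w' i * v' i j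
    -- Frobenius norm of the matrix whose i-th row is v'_i
    let frob : ℝ := Real.sqrt (∑ i, ∑ j, (v' i j) ^ 2)
    norm2 (fun j => Attn j - Attn' j) ≤
      frob / (2 * Real.sqrt d) * ∑ i, |inner q (fun j => k i j - k' i j)|
        + ∑ i, norm2 (fun j => v i j - v' i j) := by
  intro inner norm2 w w' Attn Attn' frob
  have hrow : ∀ i, ‖WithLp.toLp 2 (v' i)‖ ≤ frob := fun i => by
    rw [← sqrt_sum_sq_eq_norm]
    exact Real.sqrt_le_sqrt (single_le_sum (f := fun i => ∑ j, v' i j ^ 2)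
      (fun _ _ => sum_nonneg fun _ _ => sq_nonneg _) (mem_univ i))
  have hlogit : ∀ i, |w i - w' i| = |inner q (fun j => k i j - k' i j)| / Real.sqrt d := fun i => by
    simp only [w, w', inner]
    rw [← sub_div, abs_div, abs_of_nonneg (Real.sqrt_nonneg _), ← sum_sub_distrib]
    simp only [mul_sub]
  have hsoft := sum_abs_softmax_sub_le hn w w'
  simp only [hlogit, ← sum_div] at hsoft
  have hAttn : WithLp.toLp 2 (fun j => Attn j - Attn' j) =
      ∑ i, softmax w i • WithLp.toLp 2 (v i) - ∑ i, softmax w' i • WithLp.toLp 2 (v' i) := by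
    ext j
    simp [Attn, Attn']
  have hdiff : ∀ i, norm2 (fun j => v i j - v' i j) =
      ‖WithLp.toLp 2 (v i) - WithLp.toLp 2 (v' i)‖ := fun i => sqrt_sum_sq_eq_norm _
  calc norm2 (fun j => Attn j - Attn' j)
      = ‖∑ i, softmax w i • WithLp.toLp 2 (v i) - ∑ i, softmax w' i • WithLp.toLp 2 (v' i)‖ := by
        rw [← hAttn]
        exact sqrt_sum_sq_eq_norm _
    _ ≤ frob * ∑ i, |softmax w i - softmax w' i| +
          ∑ i, ‖WithLp.toLp 2 (v i) - WithLp.toLp 2 (v' i)‖ :=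
        norm_sum_smul_sub_sum_smul_le _ _ _ _
          (fun i => (abs_of_nonneg (softmax_nonneg w i)).trans_le (softmax_le_one w i)) hrow
    _ ≤ frob * (1 / 2 * ((∑ i, |inner q (fun j => k i j - k' i j)|) / Real.sqrt d)) +
          ∑ i, ‖WithLp.toLp 2 (v i) - WithLp.toLp 2 (v' i)‖ := by
        gcongr
    _ = _ := by
        simp only [hdiff]
        ring
end

section
/- The softmax function is 1/2-Lipschitz in the Euclidean norm: for every positive integer n and all x, y ∈ ℝ^n, ‖softmax(x) − softmax(y)‖₂ ≤ (1/2)·‖x − y‖₂. -/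
open Finset

section Variance

variable {ι : Type*} [Fintype ι] {p : ι → ℝ}

/-- The variance of `u` under the weights `p` is nonnegative. -/
lemma sq_sum_mul_le_sum_mul_sq (hp : ∀ i, 0 ≤ p i) (hp1 : ∑ i, p i = 1) (u : ι → ℝ) :
    (∑ i, p i * u i) ^ 2 ≤ ∑ i, p i * u i ^ 2 := by
  have h := sum_sq_le_sum_mul_sum_of_sq_le_mul univ (r := fun i => p i * u i) (f := p)
    (g := fun i => p i * u i ^ 2) (fun i _ => hp i)
    (fun i _ => mul_nonneg (hp i) (sq_nonneg _)) (fun i _ => le_of_eq (by ring))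
  simpa [hp1] using h

/-- The variance of `u` under the weights `p` is at most half the squared Euclidean norm of `u`. -/
lemma sum_mul_sq_sub_sq_sum_mul_le (hp : ∀ i, 0 ≤ p i) (hp1 : ∑ i, p i = 1) (u : ι → ℝ) :
    ∑ i, p i * u i ^ 2 - (∑ i, p i * u i) ^ 2 ≤ (∑ i, u i ^ 2) / 2 := by
  set m := ∑ i, p i * u i with hm
  set s := ∑ i, p i * u i ^ 2 with hs
  have row (i : ι) : 4 * p i * u i ^ 2 ≤ u i ^ 2 + 2 * u i * m + s := by
    have h := single_le_sum (f := fun j => p j * (u i + u j) ^ 2)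
      (fun j _ => mul_nonneg (hp j) (sq_nonneg _)) (mem_univ i)
    have e : ∑ j, p j * (u i + u j) ^ 2 = (∑ j, p j) * u i ^ 2 + 2 * u i * m + s := by
      rw [hm, hs, sum_mul, mul_sum, ← sum_add_distrib, ← sum_add_distrib]
      exact sum_congr rfl fun j _ => by ring
    rw [e, hp1] at h
    linarith
  have bound : ∑ i, (2 * (p i * u i ^ 2) - u i ^ 2 / 2) ≤
      ∑ i, (p i * u i ^ 2 + 2 * m * (p i * u i) + s * p i) / 2 := by
    refine sum_le_sum fun i _ => ?_
    have h := mul_le_mul_of_nonneg_left (row i) (hp i)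
    nlinarith [mul_nonneg (sq_nonneg (2 * p i - 1)) (sq_nonneg (u i))]
  rw [← sum_div, sum_add_distrib, sum_add_distrib, sum_sub_distrib, ← mul_sum, ← mul_sum,
    ← mul_sum, ← sum_div, hp1, ← hm, ← hs] at bound
  linarith

/-- The covariance of `u` and `v` under the weights `p`, bounded by Euclidean norms. -/
lemma sum_mul_mul_sub_mul_le (hp : ∀ i, 0 ≤ p i) (hp1 : ∑ i, p i = 1) (u v : ι → ℝ) :
    ∑ i, p i * (u i * v i) - (∑ i, p i * u i) * ∑ i, p i * v i ≤
      (∑ i, u i ^ 2) / 8 + (∑ i, v i ^ 2) / 2 := by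
  have h := sq_sum_mul_le_sum_mul_sq hp hp1 (fun i => u i / 2 - v i)
  have e₁ : ∑ i, p i * (u i / 2 - v i) = (∑ i, p i * u i) / 2 - ∑ i, p i * v i := by
    rw [sum_div, ← sum_sub_distrib]
    exact sum_congr rfl fun i _ => by ring
  have e₂ : ∑ i, p i * (u i / 2 - v i) ^ 2 =
      (∑ i, p i * u i ^ 2) / 4 - ∑ i, p i * (u i * v i) + ∑ i, p i * v i ^ 2 := by
    rw [sum_div, ← sum_sub_distrib, ← sum_add_distrib]
    exact sum_congr rfl fun i _ => by ring
  rw [e₁, e₂] at h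
  linarith [sum_mul_sq_sub_sq_sum_mul_le hp hp1 u, sum_mul_sq_sub_sq_sum_mul_le hp hp1 v]

end Variance

lemma sum_exp_pos {n : ℕ} (hn : 0 < n) (x : Fin n → ℝ) : 0 < ∑ j, Real.exp (x j) :=
  sum_pos (fun _ _ => Real.exp_pos _) ⟨⟨0, hn⟩, mem_univ _⟩

lemma sum_softmax {n : ℕ} (hn : 0 < n) (x : Fin n → ℝ) : ∑ i, softmax x i = 1 := by
  simp only [softmax, ← sum_div]
  exact div_self (sum_exp_pos hn x).ne'

/-- The derivative of a linear functional of softmax along a line is a covariance. -/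
lemma hasDerivAt_sum_softmax_mul {n : ℕ} (hn : 0 < n) (y u v : Fin n → ℝ) (t : ℝ) :
    HasDerivAt (fun t : ℝ => ∑ i, softmax (fun j => y j + t * u j) i * v i)
      (∑ i, softmax (fun j => y j + t * u j) i * (u i * v i) -
        (∑ i, softmax (fun j => y j + t * u j) i * u i) *
          ∑ i, softmax (fun j => y j + t * u j) i * v i) t := by
  have hexp (i : Fin n) : HasDerivAt (fun t : ℝ => Real.exp (y i + t * u i))
      (Real.exp (y i + t * u i) * u i) t := by
    simpa using (((hasDerivAt_id t).mul_const (u i)).const_add (y i)).exp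
  have hS := (sum_exp_pos hn fun j => y j + t * u j).ne'
  have hsum := HasDerivAt.fun_sum fun i (_ : i ∈ univ) => hexp i
  have h := HasDerivAt.fun_sum fun i (_ : i ∈ univ) =>
    ((hexp i).fun_div hsum hS).mul_const (v i)
  refine h.congr_deriv ?_
  rw [mul_sum, ← sum_sub_distrib]
  refine sum_congr rfl fun i _ => ?_
  simp only [softmax, div_mul_eq_mul_div, ← sum_div]
  field_simp

/-- The softmax function is `1/2`-Lipschitz with respect to the Euclidean norm. -/
theorem softmax_half_lipschitz (n : ℕ) (hn : 0 < n) (x y : Fin n → ℝ) :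
    Real.sqrt (∑ i, (softmax x i - softmax y i) ^ 2) ≤
      (1 / 2) * Real.sqrt (∑ i, (x i - y i) ^ 2) := by
  have hd := hasDerivAt_sum_softmax_mul hn y (fun i => x i - y i)
    (fun i => softmax x i - softmax y i)
  obtain ⟨t, -, ht⟩ := exists_hasDerivAt_eq_slope _ _ zero_lt_one
    (fun t _ => (hd t).continuousAt.continuousWithinAt) (fun t _ => hd t)
  have hcov := sum_mul_mul_sub_mul_le (softmax_nonneg fun j => y j + t * (x j - y j))
    (sum_softmax hn _) (fun i => x i - y i) (fun i => softmax x i - softmax y i)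
  rw [ht] at hcov
  simp only [one_mul, zero_mul, add_zero, add_sub_cancel, sub_zero, div_one,
    ← sum_sub_distrib, ← sub_mul, ← sq] at hcov
  rw [Real.sqrt_le_left (by positivity), mul_pow, Real.sq_sqrt (by positivity)]
  linarith
end

section
/- Let d, g, t, r be positive integers with t·g < d, let λ ≥ 0, and let Q̂ ∈ ℝ^{r×d}. Set P_inv := (I_d + λ Q̂ᵀ Q̂)⁻¹ and write P_inv in block form [[A_t, B_tᵀ],[B_t, C_t]], where A_t ∈ ℝ^{tg×tg} is the top-left block and B_t ∈ ℝ^{(d−tg)×tg} is the bottom-left block; A_t is invertible (being a principal submatrix of a positive definite matrix), and let H_t ∈ ℝ^{tg×g} consist of the last g columns of A_t⁻¹. Fix k ∈ ℝ^d and c ∈ ℝ^g, and consider minimizing f(x) = ‖x − k‖₂² + λ‖Q̂ (x − k)‖₂² over x ∈ ℝ^d subject to the constraints x_i = k_i for i = 1,…,(t−1)g and x_{(t−1)g+i} = c_i for i = 1,…,g. Then the constrained minimizer exists, is unique, and its last d − tg coordinates are given by (x)_{tg+1:d} = (k)_{tg+1:d} + B_t H_t (c − (k)_{(t−1)g+1:tg}),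 where (k)_{(t−1)g+1:tg} ∈ ℝ^g denotes coordinates (t−1)g+1 through tg of k. -/
open Matrix Finset

namespace Matrix

variable {m n : Type*} [Fintype m] [Fintype n] [DecidableEq n]

theorem PosDef.isUnit_det_submatrix_inv [DecidableEq m] {P : Matrix n n ℝ} (hP : P.PosDef)
    {e : m → n} (he : Function.Injective e) : IsUnit (P⁻¹.submatrix e e).det :=
  (hP.inv.submatrix he).det_pos.ne'.isUnit

/-- The combination of the columns of `P⁻¹` selected by `e` with coefficients `A⁻¹ *ᵥ w`, where `A`
is the corresponding principal submatrix of `P⁻¹`, restricts to `w` along `e`. -/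
theorem PosDef.submatrix_inv_mulVec_apply [DecidableEq m] {P : Matrix n n ℝ} (hP : P.PosDef)
    {e : m → n} (he : Function.Injective e) (w : m → ℝ) (i : m) :
    (P⁻¹.submatrix id e *ᵥ ((P⁻¹.submatrix e e)⁻¹ *ᵥ w)) (e i) = w i := by
  change (P⁻¹.submatrix e e *ᵥ ((P⁻¹.submatrix e e)⁻¹ *ᵥ w)) i = w i
  rw [mulVec_mulVec, mul_nonsing_inv _ (hP.isUnit_det_submatrix_inv he), one_mulVec]

/-- A combination `z` of columns of `P⁻¹` is `P`-orthogonal to every vector vanishing at the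
indices of these columns, which gives a Pythagorean identity. -/
theorem PosDef.dotProduct_mulVec_eq_add {P : Matrix n n ℝ} (hP : P.PosDef) (e : m → n)
    (v : m → ℝ) {y z : n → ℝ} (hz : z = P⁻¹.submatrix id e *ᵥ v) (h : ∀ i, y (e i) = z (e i)) :
    y ⬝ᵥ P *ᵥ y = z ⬝ᵥ P *ᵥ z + (y - z) ⬝ᵥ P *ᵥ (y - z) := by
  have hPz : P *ᵥ z = (1 : Matrix n n ℝ).submatrix id e *ᵥ v := by
    rw [hz, mulVec_mulVec, ← mul_nonsing_inv P hP.det_pos.ne'.isUnit]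
    rfl
  have horth : (y - z) ⬝ᵥ P *ᵥ z = 0 := by
    have hcol : (y - z) ᵥ* (1 : Matrix n n ℝ).submatrix id e = 0 := by
      ext i
      have hi : ((y - z) ᵥ* (1 : Matrix n n ℝ)) (e i) = 0 := by simp [h i]
      exact hi
    rw [hPz, dotProduct_mulVec, hcol, zero_dotProduct]
  have hsymm : z ⬝ᵥ P *ᵥ (y - z) = (y - z) ⬝ᵥ P *ᵥ z := by
    have hT : Pᵀ = P := by simpa using hP.isHermitian.eq
    rw [dotProduct_mulVec, ← mulVec_transpose, hT, dotProduct_comm]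
  obtain ⟨u, rfl⟩ : ∃ u, y = z + u := ⟨y - z, by simp⟩
  simp only [add_sub_cancel_left] at horth hsymm ⊢
  rw [mulVec_add, dotProduct_add, add_dotProduct, add_dotProduct, horth, hsymm, horth]
  ring

theorem posDef_one_add_smul_transpose_mul {Q : Matrix m n ℝ} {a : ℝ} (ha : 0 ≤ a) :
    (1 + a • (Qᵀ * Q)).PosDef := by
  have h : (Qᵀ * Q).PosSemidef := by simpa using posSemidef_conjTranspose_mul_self Q
  exact PosDef.one.add_posSemidef (h.smul ha)

theorem sum_sq_add_mul_sum_sq_mulVec (Q : Matrix m n ℝ) (a : ℝ) (u : n → ℝ) :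
    (∑ i, u i ^ 2) + a * ∑ i, (Q *ᵥ u) i ^ 2 = u ⬝ᵥ (1 + a • (Qᵀ * Q)) *ᵥ u := by
  have h : u ⬝ᵥ (Qᵀ * Q) *ᵥ u = (Q *ᵥ u) ⬝ᵥ (Q *ᵥ u) := by
    rw [← mulVec_mulVec, dotProduct_mulVec, vecMul_transpose]
  rw [add_mulVec, one_mulVec, smul_mulVec, dotProduct_add, dotProduct_smul, h]
  simp [dotProduct, pow_two]

end Matrix

/-- **Lemma 3** (block-wise quantization update): closed form of the optimal update of the
not-yet-quantized coordinates when a block of `g` coordinates is fixed to prescribed values. -/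
theorem blockwise_quantization_update (d g t r : ℕ)
    (hd : 0 < d) (hg : 0 < g) (ht : 0 < t) (hr : 0 < r) (htg : t * g < d)
    (lam : ℝ) (hlam : 0 ≤ lam) (Qhat : Matrix (Fin r) (Fin d) ℝ)
    (k : Fin d → ℝ) (c : Fin g → ℝ) :
    -- P_inv = (I_d + λ Q̂ᵀ Q̂)⁻¹
    let Pinv : Matrix (Fin d) (Fin d) ℝ := (1 + lam • (Qhatᵀ * Qhat))⁻¹
    -- embedding of the first t·g coordinates into Fin d
    let emb1 : Fin (t * g) → Fin d := fun i => ⟨i.1, i.2.trans htg⟩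
    -- embedding of the last d − t·g coordinates into Fin d
    let emb2 : Fin (d - t * g) → Fin d := fun i => ⟨t * g + i.1, by omega⟩
    -- embedding of the current block (coordinates (t−1)g+1, …, tg) into Fin (t·g)
    let embBlk : Fin g → Fin (t * g) := fun j =>
      ⟨(t - 1) * g + j.1, by
        have h1 : (t - 1) * g + g = t * g := by
          cases t with
          | zero => omega
          | succ s => simp [Nat.succ_sub_one, Nat.succ_mul]
        omega⟩
    -- A_t : top-left (t·g)×(t·g) block of P_inv
    let A : Matrix (Fin (t * g)) (Fin (t * g)) ℝ := fun i j => Pinv (emb1 i) (emb1 j)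
    -- B_t : bottom-left (d−t·g)×(t·g) block of P_inv
    let B : Matrix (Fin (d - t * g)) (Fin (t * g)) ℝ := fun i j => Pinv (emb2 i) (emb1 j)
    -- H_t : last g columns of A_t⁻¹
    let H : Matrix (Fin (t * g)) (Fin g) ℝ := fun i j => A⁻¹ i (embBlk j)
    -- objective f(x) = ‖x − k‖₂² + λ‖Q̂(x − k)‖₂²
    let f : (Fin d → ℝ) → ℝ := fun x =>
      (∑ i, (x i - k i) ^ 2) + lam * ∑ i, ((Qhat *ᵥ fun j => x j - k j) i) ^ 2
    -- constraints: x agrees with k on the first (t−1)g coordinates, and equals c on the block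
    let feasible : (Fin d → ℝ) → Prop := fun x =>
      (∀ i : Fin d, i.1 < (t - 1) * g → x i = k i) ∧
      (∀ j : Fin g, x (emb1 (embBlk j)) = c j)
    -- A_t is invertible (principal submatrix of a positive definite matrix)
    IsUnit A.det ∧
      -- the constrained minimizer exists, is unique, and its last d − t·g coordinates
      -- are given by k + B_t H_t (c − k_block)
      ∃ xstar : Fin d → ℝ,
        feasible xstar ∧ (∀ x, feasible x → f xstar ≤ f x) ∧
        (∀ y, feasible y → (∀ x, feasible x → f y ≤ f x) → y = xstar) ∧
        (∀ j : Fin (d - t * g),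
          xstar (emb2 j) =
            k (emb2 j) + ∑ l, (B * H) j l * (c l - k (emb1 (embBlk l)))) := by
  intro Pinv emb1 emb2 embBlk A B H f feasible
  set P : Matrix (Fin d) (Fin d) ℝ := 1 + lam • (Qhatᵀ * Qhat)
  have hP : P.PosDef := posDef_one_add_smul_transpose_mul hlam
  have htg' : (t - 1) * g + g = t * g := by
    rw [← Nat.succ_mul, Nat.succ_eq_add_one, Nat.sub_add_cancel ht]
  have hemb1 : Function.Injective emb1 := fun i j hij => by
    simpa [emb1, Fin.ext_iff] using hij
  have hembBlk : Function.Injective embBlk := fun i j hij => by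
    simpa [embBlk, Fin.ext_iff] using hij
  have hA : IsUnit A.det := hP.isUnit_det_submatrix_inv hemb1
  have hf (x : Fin d → ℝ) : f x = (x - k) ⬝ᵥ P *ᵥ (x - k) :=
    sum_sq_add_mul_sum_sq_mulVec Qhat lam (x - k)
  let δ : Fin g → ℝ := fun l => c l - k (emb1 (embBlk l))
  let w : Fin (t * g) → ℝ := (1 : Matrix _ _ ℝ).submatrix id embBlk *ᵥ δ
  have hwBlk (l : Fin g) : w (embBlk l) = δ l := by
    simp [w, mulVec, dotProduct, one_apply, hembBlk.eq_iff]
  have hwLt (i : Fin (t * g)) (hi : i.1 < (t - 1) * g) : w i = 0 := by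
    have hne (l : Fin g) : i ≠ embBlk l := fun h => by
      have := congrArg Fin.val h
      simp only [embBlk] at this
      omega
    simp [w, mulVec, dotProduct, one_apply, hne]
  have hAw : A⁻¹ *ᵥ w = H *ᵥ δ := by
    have hAH : A⁻¹ * (1 : Matrix _ _ ℝ).submatrix id embBlk = H := by
      conv_rhs => rw [show H = (A⁻¹).submatrix id embBlk from rfl, ← mul_one A⁻¹]
      rfl
    exact (mulVec_mulVec _ _ _).trans (congrArg (· *ᵥ δ) hAH)
  let z : Fin d → ℝ := P⁻¹.submatrix id emb1 *ᵥ (A⁻¹ *ᵥ w)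
  have hz (i : Fin (t * g)) : z (emb1 i) = w i := hP.submatrix_inv_mulVec_apply hemb1 w i
  have hfeas (x : Fin d → ℝ) : feasible x ↔ ∀ i, (x - k) (emb1 i) = w i := by
    constructor
    · rintro ⟨hlt, hblk⟩ i
      by_cases hi : i.1 < (t - 1) * g
      · simp [hwLt i hi, hlt (emb1 i) hi]
      · obtain ⟨l, rfl⟩ : ∃ l, embBlk l = i :=
          ⟨⟨i.1 - (t - 1) * g, by omega⟩, Fin.ext (by simp only [embBlk]; omega)⟩
        simp [hwBlk, hblk, δ]
    · intro h
      refine ⟨fun i hi => ?_, fun l => ?_⟩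
      · have hi' := h ⟨i.1, by omega⟩
        rw [hwLt _ hi] at hi'
        exact sub_eq_zero.mp hi'
      · have hl := h (embBlk l)
        rw [hwBlk] at hl
        simpa [δ] using hl
  have hpyth (x : Fin d → ℝ) (hx : feasible x) :
      f x = f (k + z) + (x - k - z) ⬝ᵥ P *ᵥ (x - k - z) := by
    rw [hf, hf, add_sub_cancel_left]
    exact hP.dotProduct_mulVec_eq_add emb1 (A⁻¹ *ᵥ w) rfl
      fun i => ((hfeas x).1 hx i).trans (hz i).symm
  have hfeasz : feasible (k + z) := (hfeas _).2 fun i => by simp [hz]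
  refine ⟨hA, k + z, hfeasz, fun x hx => ?_, fun y hy hmin => ?_, fun j => ?_⟩
  · rw [hpyth x hx]
    have := hP.posSemidef.dotProduct_mulVec_nonneg (x - k - z)
    simp only [star_trivial] at this
    linarith
  · by_contra hne
    have hne' : y - k - z ≠ 0 := fun h => hne (by rwa [sub_sub, sub_eq_zero] at h)
    have := hP.dotProduct_mulVec_pos hne'
    simp only [star_trivial] at this
    linarith [hpyth y hy, hmin _ hfeasz]
  · have hzB : z (emb2 j) = (B *ᵥ (A⁻¹ *ᵥ w)) j := rfl
    rw [Pi.add_apply, hzB, hAw, mulVec_mulVec]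
    rfl
end

section
/- Let d, t, r be positive integers with t < d, let λ ≥ 0, and let Q̂ ∈ ℝ^{r×d}. Set P_inv := (I_d + λ Q̂ᵀ Q̂)⁻¹ and write P_inv in block form [[A_t, B_tᵀ],[B_t, C_t]], where A_t ∈ ℝ^{t×t} is the top-left block and B_t ∈ ℝ^{(d−t)×t} is the bottom-left block; A_t is invertible, and let h_t ∈ ℝ^t be the last column of A_t⁻¹. Fix k ∈ ℝ^d and a scalar c ∈ ℝ, and consider minimizing f(x) = ‖x − k‖₂² + λ‖Q̂ (x − k)‖₂² over x ∈ ℝ^d subject to x_i = k_i for i = 1,…,t−1 and x_t = c. Then the constrained minimizer exists, is unique, and its last d − t coordinates are given by (x)_{t+1:d} = (k)_{t+1:d} + (c − k_t) · B_t h_t. -/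
open Matrix Finset

/-- A vector in the range of the columns `g` of `M⁻¹` is `M`-orthogonal to every vector vanishing
on `g`, so the quadratic form of `M` splits along such a pair. -/
theorem dotProduct_mulVec_add_of_inv_columns {ι κ : Type*} [Fintype ι] [DecidableEq ι] [Fintype κ]
    {M : Matrix ι ι ℝ} (hM : M.PosDef) (g : κ → ι) (v : κ → ℝ) (w : ι → ℝ)
    (hw : ∀ j, w (g j) = 0) :
    let s := M⁻¹.submatrix id g *ᵥ v
    (s + w) ⬝ᵥ (M *ᵥ (s + w)) = s ⬝ᵥ (M *ᵥ s) + w ⬝ᵥ (M *ᵥ w) := by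
  intro s
  have hMs : M *ᵥ s = (1 : Matrix ι ι ℝ).submatrix id g *ᵥ v := by
    have hmul : M * M⁻¹.submatrix id g = (1 : Matrix ι ι ℝ).submatrix id g := by
      rw [← mul_nonsing_inv M ((isUnit_iff_isUnit_det M).1 hM.isUnit)]
      rfl
    rw [mulVec_mulVec, hmul]
  have hws : w ⬝ᵥ (M *ᵥ s) = 0 := by
    have hwg : w ᵥ* (1 : Matrix ι ι ℝ).submatrix id g = 0 := by
      ext j
      simp [vecMul, dotProduct, one_apply, hw]
    rw [hMs, dotProduct_mulVec, hwg, zero_dotProduct]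
  have hsw : s ⬝ᵥ (M *ᵥ w) = 0 := by
    have hT : Mᵀ = M := by simpa using hM.isHermitian.eq
    rw [dotProduct_mulVec, ← mulVec_transpose, hT, dotProduct_comm, hws]
  simp [mulVec_add, add_dotProduct, dotProduct_add, hws, hsw]

theorem posDef_one_add_smul_transpose_mul_self {ι κ : Type*} [Fintype ι] [DecidableEq ι]
    [Fintype κ] {lam : ℝ} (hlam : 0 ≤ lam) (Q : Matrix κ ι ℝ) :
    (1 + lam • (Qᵀ * Q)).PosDef := by
  have hQ : (Qᵀ * Q).PosSemidef := by
    simpa using posSemidef_conjTranspose_mul_self Q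
  exact PosDef.one.add_posSemidef (hQ.smul hlam)

theorem dotProduct_one_add_smul_transpose_mul_self_mulVec {ι κ : Type*} [Fintype ι]
    [DecidableEq ι] [Fintype κ] (lam : ℝ) (Q : Matrix κ ι ℝ) (z : ι → ℝ) :
    z ⬝ᵥ ((1 + lam • (Qᵀ * Q)) *ᵥ z) = (∑ i, z i ^ 2) + lam * ∑ i, (Q *ᵥ z) i ^ 2 := by
  rw [add_mulVec, one_mulVec, smul_mulVec, dotProduct_add, dotProduct_smul, ← mulVec_mulVec,
    dotProduct_mulVec, vecMul_transpose]
  simp [dotProduct, pow_two]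

/-- **Proposition 1** (element-by-element quantization update, the g = 1 case): closed form of
the optimal update of the remaining coordinates when the t-th coordinate is fixed to `c`. -/
theorem elementwise_quantization_update (d t r : ℕ)
    (hd : 0 < d) (ht : 0 < t) (hr : 0 < r) (htd : t < d)
    (lam : ℝ) (hlam : 0 ≤ lam) (Qhat : Matrix (Fin r) (Fin d) ℝ)
    (k : Fin d → ℝ) (c : ℝ) :
    -- P_inv = (I_d + λ Q̂ᵀ Q̂)⁻¹
    let Pinv : Matrix (Fin d) (Fin d) ℝ := (1 + lam • (Qhatᵀ * Qhat))⁻¹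
    -- embedding of the first t coordinates into Fin d
    let emb1 : Fin t → Fin d := fun i => ⟨i.1, i.2.trans htd⟩
    -- embedding of the last d − t coordinates into Fin d
    let emb2 : Fin (d - t) → Fin d := fun i => ⟨t + i.1, by omega⟩
    -- the t-th coordinate (1-indexed), as an index of Fin t
    let idxT : Fin t := ⟨t - 1, by omega⟩
    -- A_t : top-left t×t block of P_inv
    let A : Matrix (Fin t) (Fin t) ℝ := fun i j => Pinv (emb1 i) (emb1 j)
    -- B_t : bottom-left (d−t)×t block of P_inv
    let B : Matrix (Fin (d - t)) (Fin t) ℝ := fun i j => Pinv (emb2 i) (emb1 j)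
    -- h_t : last column of A_t⁻¹
    let h : Fin t → ℝ := fun i => A⁻¹ i idxT
    -- objective f(x) = ‖x − k‖₂² + λ‖Q̂(x − k)‖₂²
    let f : (Fin d → ℝ) → ℝ := fun x =>
      (∑ i, (x i - k i) ^ 2) + lam * ∑ i, ((Qhat *ᵥ fun j => x j - k j) i) ^ 2
    -- constraints: x agrees with k on the first t−1 coordinates, and x_t = c
    let feasible : (Fin d → ℝ) → Prop := fun x =>
      (∀ i : Fin d, i.1 < t - 1 → x i = k i) ∧ x (emb1 idxT) = c
    -- A_t is invertible (principal submatrix of a positive definite matrix)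
    IsUnit A.det ∧
      -- the constrained minimizer exists, is unique, and its last d − t coordinates
      -- are given by k + (c − k_t) · B_t h_t
      ∃ xstar : Fin d → ℝ,
        feasible xstar ∧ (∀ x, feasible x → f xstar ≤ f x) ∧
        (∀ y, feasible y → (∀ x, feasible x → f y ≤ f x) → y = xstar) ∧
        (∀ j : Fin (d - t),
          xstar (emb2 j) = k (emb2 j) + (c - k (emb1 idxT)) * (B *ᵥ h) j) := by
  intro Pinv emb1 emb2 idxT A B h f feasible
  have hM := posDef_one_add_smul_transpose_mul_self hlam Qhat
  have hA : A.PosDef := hM.inv.submatrix (e := emb1) fun i j hij => by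
    simpa [emb1, Fin.ext_iff] using hij
  have hdet : IsUnit A.det := (isUnit_iff_isUnit_det A).1 hA.isUnit
  refine ⟨hdet, ?_⟩
  set M := 1 + lam • (Qhatᵀ * Qhat) with hMdef
  set a := c - k (emb1 idxT) with ha
  set s := Pinv.submatrix id emb1 *ᵥ (a • h) with hs
  have hs_apply (i : Fin t) : s (emb1 i) = a * (1 : Matrix (Fin t) (Fin t) ℝ) i idxT := by
    rw [hs, mulVec_smul, Pi.smul_apply, smul_eq_mul, ← mul_nonsing_inv A hdet]
    rfl
  have hf (z : Fin d → ℝ) : f (k + z) = z ⬝ᵥ (M *ᵥ z) := by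
    simp [f, hMdef, dotProduct_one_add_smul_transpose_mul_self_mulVec]
  have hsplit (x : Fin d → ℝ) (hx : feasible x) :
      f x = f (k + s) + (x - (k + s)) ⬝ᵥ (M *ᵥ (x - (k + s))) := by
    have hw (j : Fin t) : (x - (k + s)) (emb1 j) = 0 := by
      simp only [Pi.sub_apply, Pi.add_apply, hs_apply]
      by_cases hj : j = idxT
      · subst hj
        simp [hx.2, ha]
      · have hjt : j.1 < t - 1 := by
          have hne : j.1 ≠ t - 1 := fun hne => hj (Fin.ext hne)
          omega
        simp [hx.1 (emb1 j) hjt, one_apply_ne hj]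
    have hadd : x = k + (s + (x - (k + s))) := by abel
    conv_lhs => rw [hadd]
    rw [hf, hf]
    exact dotProduct_mulVec_add_of_inv_columns hM emb1 (a • h) _ hw
  have hfeas : feasible (k + s) := by
    refine ⟨fun i hi => ?_, ?_⟩
    · have hit : i.1 < t := by omega
      have hne : (⟨i.1, hit⟩ : Fin t) ≠ idxT := fun hne => hi.ne (congrArg Fin.val hne)
      have hsi : s i = 0 := by simpa [one_apply_ne hne] using hs_apply ⟨i.1, hit⟩
      simp [hsi]
    · simp [hs_apply, ha]
  refine ⟨k + s, hfeas, fun x hx => ?_, fun y hy hmin => ?_, fun j => ?_⟩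
  · rw [hsplit x hx]
    simpa using hM.posSemidef.dotProduct_mulVec_nonneg (x - (k + s))
  · by_contra hne
    have hpos : 0 < (y - (k + s)) ⬝ᵥ (M *ᵥ (y - (k + s))) := by
      simpa using hM.dotProduct_mulVec_pos (sub_ne_zero.2 hne)
    have hle := hmin (k + s) hfeas
    linarith [hsplit y hy]
  · rw [Pi.add_apply, hs, mulVec_smul]
    rfl
end
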